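/- arXiv:math/0611122 — 3 statements merged into one kernel-verified Lean document; each statement's English description precedes it below -/
import Mathlib

section
/- For every integer d ≥ 2 and every i with 2 ≤ i ≤ d, the polynomial z_i = Σ_{k=0}^{i−2} (−1)^k · binom(i,k) · x_{i−k} · x_1^k · t^{i−k−1} + (i−1)·(−1)^{i+1} · x_1^i in ℂ[t, x_1, …, x_d] is annihilated by the derivation D1, i.e. D1(z_i) = 0. -/
open MvPolynomial Finset
open scoped Fin.NatCast

/-- The derivation `D1 = t·∂/∂x₁ + 2x₁·∂/∂x₂ + ⋯ + d·x_{d−1}·∂/∂x_d` on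
`ℂ[t, x₁, …, x_d]`, where the variable of index `0` is `t` and the variable of
index `j ≥ 1` is `x_j`. -/
noncomputable def D1 (d : ℕ) :
    Derivation ℂ (MvPolynomial (Fin (d + 1)) ℂ) (MvPolynomial (Fin (d + 1)) ℂ) :=
  MvPolynomial.mkDerivation ℂ (fun i =>
    if (i : ℕ) = 0 then 0
    else ((i : ℕ) : ℂ) •
      MvPolynomial.X (⟨(i : ℕ) - 1, lt_of_le_of_lt (Nat.sub_le _ _) i.isLt⟩ : Fin (d + 1)))

/-- The semi-invariant
`z_i = Σ_{k=0}^{i−2} (−1)^k·binom(i,k)·x_{i−k}·x₁^k·t^{i−k−1} + (i−1)·(−1)^{i+1}·x₁^i`. -/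
noncomputable def Z (d i : ℕ) : MvPolynomial (Fin (d + 1)) ℂ :=
  (∑ k ∈ Finset.range (i - 1),
      MvPolynomial.C ((-1 : ℂ) ^ k * (i.choose k : ℂ)) *
        MvPolynomial.X (((i - k : ℕ) : Fin (d + 1))) *
        (MvPolynomial.X ((1 : ℕ) : Fin (d + 1))) ^ k *
        (MvPolynomial.X ((0 : ℕ) : Fin (d + 1))) ^ (i - k - 1)) +
    MvPolynomial.C (((i : ℂ) - 1) * (-1 : ℂ) ^ (i + 1)) *
      (MvPolynomial.X ((1 : ℕ) : Fin (d + 1))) ^ i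

theorem D1_X_zero (d : ℕ) : D1 d (X ((0 : ℕ) : Fin (d + 1))) = 0 := by
  simp [D1, mkDerivation_X]

theorem D1_X_succ (d n : ℕ) (h : n + 1 ≤ d) :
    D1 d (X ((n + 1 : ℕ) : Fin (d + 1))) =
      ((n : MvPolynomial (Fin (d + 1)) ℂ) + 1) * X ((n : ℕ) : Fin (d + 1)) := by
  have e : (((n + 1 : ℕ) : Fin (d + 1)) : ℕ) = n + 1 := by
    rw [Fin.val_natCast, Nat.mod_eq_of_lt (by omega)]
  have e' : ((n : ℕ) : Fin (d + 1)) = ⟨n, by omega⟩ := by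
    apply Fin.ext
    rw [Fin.val_natCast, Nat.mod_eq_of_lt (by omega)]
  rw [D1, mkDerivation_X, e']
  simp only [e]
  simp [MvPolynomial.smul_eq_C_mul]

/-- For every integer `d ≥ 2` and every `i` with `2 ≤ i ≤ d`, the polynomial `z_i`
is annihilated by the derivation `D1`. -/
theorem D1_Z_eq_zero (d : ℕ) (hd : 2 ≤ d) (i : ℕ) (h2 : 2 ≤ i) (hid : i ≤ d) :
    D1 d (Z d i) = 0 := by
  obtain ⟨m, rfl⟩ : ∃ m, i = m + 2 := ⟨i - 2, by omega⟩
  have h0 := D1_X_zero d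
  have h1 := D1_X_succ d 0 (by omega)
  have hX := D1_X_succ d
  unfold Z
  generalize hx : (fun n : ℕ => (X ((n : ℕ) : Fin (d + 1)) : MvPolynomial (Fin (d + 1)) ℂ)) = x
  have hx' : ∀ n : ℕ, (X ((n : ℕ) : Fin (d + 1)) : MvPolynomial (Fin (d + 1)) ℂ) = x n :=
    fun n => congrFun hx n
  simp only [hx'] at h0 h1 hX ⊢
  clear hx hx'
  let g : ℕ → MvPolynomial (Fin (d + 1)) ℂ := fun k =>
    (-1) ^ k * ((m + 2).choose k : MvPolynomial (Fin (d + 1)) ℂ) * k * x (m + 2 - k) *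
      x 1 ^ (k - 1) * x 0 ^ (m + 2 - k)
  have hterm : ∀ k ∈ Finset.range (m + 2 - 1),
      D1 d (C ((-1 : ℂ) ^ k * ((m + 2).choose k : ℂ)) * x (m + 2 - k) * x 1 ^ k *
        x 0 ^ (m + 2 - k - 1)) = g k - g (k + 1) := by
    intro k hk
    rw [Finset.mem_range] at hk
    obtain ⟨r, hr⟩ : ∃ r, m + 2 = k + r + 2 := ⟨m - k, by omega⟩
    have hc := Nat.choose_succ_right_eq (m + 2) k
    have hc' := congrArg (Nat.cast : ℕ → MvPolynomial (Fin (d + 1)) ℂ) hc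
    have e1 : m + 2 - k = r + 1 + 1 := by omega
    have e2 : m + 2 - (k + 1) = r + 1 := by omega
    simp only [g, e1, e2, Nat.add_sub_cancel] at hc' ⊢
    push_cast at hc'
    have hr1 := hX (r + 1) (by omega)
    simp only [Derivation.leibniz, Derivation.leibniz_pow, MvPolynomial.derivation_C, hr1, h0, h1,
      smul_eq_mul, nsmul_eq_mul]
    simp only [map_mul, map_pow, map_neg, map_one, map_natCast]
    push_cast
    linear_combination ((-1) ^ k * x (r + 1) * x 1 ^ k * x 0 ^ (r + 1)) * (-hc')
  rw [map_add, map_sum, Finset.sum_congr rfl hterm, Finset.sum_range_sub']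
  have e3 : m + 2 - (m + 1) = 1 := by omega
  have e4 : m + 2 - 1 = m + 1 := by omega
  have e5 : (m + 2).choose (m + 1) = m + 2 := Nat.choose_succ_self_right (m + 1)
  simp only [g, e3, e4, e5, Derivation.leibniz, Derivation.leibniz_pow, MvPolynomial.derivation_C,
    h1, smul_eq_mul, nsmul_eq_mul]
  simp only [map_mul, map_pow, map_neg, map_one, map_sub, map_natCast,
    Nat.add_sub_cancel]
  push_cast
  ring
end

section
/- For every integer d ≥ 2, the d elements t, z_2, z_3, …, z_d of the polynomial ring ℂ[t, x_1, …, x_d] are algebraically independent over ℂ. -/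
open MvPolynomial Finset
open scoped Fin.NatCast

/-- Target of the specialisation: `t ↦ y₀`, `x₁ ↦ 0`, `x_n ↦ y_{n-1} / y₀^(n-1)`. -/
noncomputable def specVal (d : ℕ) (hd : 2 ≤ d) (n : Fin (d + 1)) :
    FractionRing (MvPolynomial (Fin d) ℂ) :=
  if n.val = 0 then algebraMap _ _ (X (⟨0, by omega⟩ : Fin d) : MvPolynomial (Fin d) ℂ)
  else if n.val = 1 then 0
  else algebraMap _ _ (X (⟨n.val - 1, by omega⟩ : Fin d) : MvPolynomial (Fin d) ℂ) /
    (algebraMap _ _ (X (⟨0, by omega⟩ : Fin d) : MvPolynomial (Fin d) ℂ)) ^ (n.val - 1)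

theorem algebraicIndependent_t_Z (d : ℕ) (hd : 2 ≤ d) :
    AlgebraicIndependent ℂ (fun j : Fin d =>
      if (j : ℕ) = 0 then (MvPolynomial.X ((0 : ℕ) : Fin (d + 1)) : MvPolynomial (Fin (d + 1)) ℂ)
      else Z d ((j : ℕ) + 1)) := by
  apply AlgebraicIndependent.of_comp (aeval (R := ℂ) (specVal d hd))
  have hinj : Function.Injective
      (algebraMap (MvPolynomial (Fin d) ℂ) (FractionRing (MvPolynomial (Fin d) ℂ))) :=
    IsFractionRing.injective _ _
  have key := (algebraicIndependent_X (Fin d) ℂ).map'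
    (f := IsScalarTower.toAlgHom ℂ (MvPolynomial (Fin d) ℂ)
      (FractionRing (MvPolynomial (Fin d) ℂ))) hinj
  have h0 : specVal d hd ((0 : ℕ) : Fin (d + 1)) =
      algebraMap _ _ (X (⟨0, by omega⟩ : Fin d) : MvPolynomial (Fin d) ℂ) := by
    simp [specVal]
  have h1 : specVal d hd ((1 : ℕ) : Fin (d + 1)) = 0 := by
    have : ((1 : ℕ) : Fin (d + 1)).val = 1 := Fin.val_cast_of_lt (by omega)
    simp only [specVal, this]
    simp
  convert key using 1
  funext j
  by_cases hj : (j : ℕ) = 0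
  · have : j = ⟨0, by omega⟩ := Fin.ext hj
    simp only [Function.comp, hj, if_true, aeval_X, h0]
    rw [this]; rfl
  · have hne : (algebraMap (MvPolynomial (Fin d) ℂ) (FractionRing (MvPolynomial (Fin d) ℂ)))
        (X (⟨0, by omega⟩ : Fin d)) ≠ 0 := by
      rw [Ne, map_eq_zero_iff _ hinj]
      exact X_ne_zero _
    have hv : (((j : ℕ) + 1 : ℕ) : Fin (d + 1)).val = (j : ℕ) + 1 :=
      Fin.val_cast_of_lt (by omega)
    have hs : specVal d hd (((j : ℕ) + 1 : ℕ) : Fin (d + 1)) =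
        algebraMap _ _ (X j : MvPolynomial (Fin d) ℂ) /
        (algebraMap _ _ (X (⟨0, by omega⟩ : Fin d) : MvPolynomial (Fin d) ℂ)) ^ (j : ℕ) := by
      simp only [specVal, hv]
      simp [hj]
    simp only [Function.comp, hj, if_false, Z, map_add, map_sum, map_mul, map_pow, aeval_X, h0, h1]
    rw [Finset.sum_eq_single 0]
    · simp only [Nat.sub_zero, hs, Nat.add_sub_cancel]
      simp [hne]
    · intro k _ hk
      simp [hk]
    · intro h
      exact absurd (Finset.mem_range.2 (by omega)) h
end

section
/- For every integer d ≥ 2 and every i with 2 ≤ i ≤ d, the semi-invariant z_i has D2-order (d−2)·i: one has (D1∘D2 − D2∘D1)(z_i) = (d−2)·i·z_i, D2^{(d−2)i + 1}(z_i) = 0, and D2^{(d−2)i}(z_i) ≠ 0. (For d = 7 this gives ord(z_2) = 10 and ord(z_3) = 15.) -/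
open MvPolynomial Finset
open scoped Fin.NatCast

/-- The derivation `D2 = d·x₁·∂/∂t + (d−1)·x₂·∂/∂x₁ + ⋯ + x_d·∂/∂x_{d−1}` on
`ℂ[t, x₁, …, x_d]`, where the variable of index `0` is `t` and the variable of
index `j ≥ 1` is `x_j`. -/
noncomputable def D2 (d : ℕ) :
    Derivation ℂ (MvPolynomial (Fin (d + 1)) ℂ) (MvPolynomial (Fin (d + 1)) ℂ) :=
  MvPolynomial.mkDerivation ℂ (fun i =>
    if h : (i : ℕ) < d then
      ((d - (i : ℕ) : ℕ) : ℂ) • MvPolynomial.X (⟨(i : ℕ) + 1, by omega⟩ : Fin (d + 1))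
    else 0)

namespace ZAux

variable {d : ℕ}

/-- The variable of index `j`. -/
noncomputable def x (d j : ℕ) : MvPolynomial (Fin (d + 1)) ℂ :=
  MvPolynomial.X ((j : ℕ) : Fin (d + 1))

lemma x_eq (j : ℕ) (hj : j < d + 1) : x d j = MvPolynomial.X (⟨j, hj⟩ : Fin (d + 1)) := by
  unfold x
  congr 1
  apply Fin.ext
  simp [Fin.val_natCast, Nat.mod_eq_of_lt hj]

lemma D1_x (j : ℕ) (hj : j ≤ d) : D1 d (x d j) = (j : ℂ) • x d (j - 1) := by
  rw [x_eq j (by omega), x_eq (j - 1) (by omega), D1, mkDerivation_X]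
  by_cases h : j = 0
  · subst h; simp
  · simp [h]

lemma D2_x (j : ℕ) (hj : j ≤ d) : D2 d (x d j) = ((d : ℂ) - j) • x d (j + 1) := by
  rcases Nat.lt_or_ge j d with h | h
  · rw [x_eq j (by omega), x_eq (j + 1) (by omega), D2, mkDerivation_X]
    simp only [h, dite_true]
    rw [Nat.cast_sub hj]
  · have : j = d := by omega
    subst this
    rw [x_eq j (by omega), D2, mkDerivation_X]
    simp

/-- The bracket. -/
noncomputable def H (d : ℕ) :
    Derivation ℂ (MvPolynomial (Fin (d + 1)) ℂ) (MvPolynomial (Fin (d + 1)) ℂ) :=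
  ⁅D1 d, D2 d⁆

lemma H_apply (p) : H d p = D1 d (D2 d p) - D2 d (D1 d p) := by
  rw [H, Derivation.commutator_apply]

lemma H_x (j : ℕ) (hj : j ≤ d) : H d (x d j) = ((d : ℂ) - 2 * j) • x d j := by
  rw [H_apply, D2_x j hj, D1_x j hj, Derivation.map_smul, Derivation.map_smul,
    D2_x (j - 1) (by omega)]
  have h1 : ((d : ℂ) - j) • D1 d (x d (j + 1)) = (((d : ℂ) - j) * (j + 1)) • x d j := by
    rcases Nat.lt_or_ge j d with h | h
    · rw [D1_x (j + 1) (by omega), smul_smul]; simp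
    · have : j = d := by omega
      subst this; simp
  rw [h1]
  rcases j with _ | j
  · simp
  · simp only [Nat.add_sub_cancel, smul_smul, ← sub_smul]
    congr 1
    push_cast
    ring

lemma H_D2 (p) : H d (D2 d p) = D2 d (H d p) - (2 : ℂ) • D2 d p := by
  have key : ⁅H d, D2 d⁆ = (-2 : ℂ) • D2 d := by
    apply MvPolynomial.derivation_ext
    rintro ⟨j, hj⟩
    rw [← x_eq j hj, Derivation.commutator_apply, H_x j (by omega), Derivation.smul_apply,
      D2_x j (by omega), Derivation.map_smul, Derivation.map_smul, D2_x j (by omega)]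
    rcases Nat.lt_or_ge j d with h | h
    · rw [H_x (j + 1) (by omega)]
      simp only [smul_smul, ← sub_smul]
      congr 1
      push_cast
      ring
    · have : j = d := by omega
      subst this; simp
  have := congrArg (fun D => D p) key
  simp only [Derivation.commutator_apply, Derivation.smul_apply] at this
  rw [sub_eq_iff_eq_add] at this
  rw [this, neg_smul]; abel

lemma eig_mul {a b : MvPolynomial (Fin (d + 1)) ℂ} {α β γ : ℂ} (ha : H d a = α • a)
    (hb : H d b = β • b) (h : γ = α + β) : H d (a * b) = γ • (a * b) := by
  rw [Derivation.leibniz, ha, hb, h]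
  simp only [smul_eq_mul, MvPolynomial.smul_eq_C_mul, map_add]
  ring

lemma eig_pow {a : MvPolynomial (Fin (d + 1)) ℂ} {α : ℂ} (ha : H d a = α • a) (n : ℕ) :
    H d (a ^ n) = (n * α) • a ^ n := by
  induction n with
  | zero => simp
  | succ n ih => rw [pow_succ]; exact eig_mul ih ha (by push_cast; ring)

lemma eig_C (c : ℂ) : H d (C c) = (0 : ℂ) • (C c) := by
  rw [zero_smul]; exact Derivation.map_algebraMap _ c

lemma eig_iter {v : MvPolynomial (Fin (d + 1)) ℂ} {c : ℂ} (hv : H d v = c • v) (k : ℕ) :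
    H d ((D2 d)^[k] v) = (c - 2 * k) • (D2 d)^[k] v := by
  induction k with
  | zero => simpa using hv
  | succ k ih =>
    rw [Function.iterate_succ_apply', H_D2, ih, Derivation.map_smul, ← sub_smul]
    congr 1; push_cast; ring

lemma D1_iter {v : MvPolynomial (Fin (d + 1)) ℂ} {c : ℂ} (hv : H d v = c • v)
    (h1 : D1 d v = 0) (k : ℕ) :
    D1 d ((D2 d)^[k + 1] v) = ((k + 1) * (c - k)) • (D2 d)^[k] v := by
  have step : ∀ w, D1 d (D2 d w) = H d w + D2 d (D1 d w) := fun w => by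
    rw [H_apply]; abel
  induction k with
  | zero => simp [step, h1, hv]
  | succ k ih =>
    rw [Function.iterate_succ_apply', step, ih, eig_iter hv, Derivation.map_smul,
      ← Function.iterate_succ_apply' (D2 d), ← add_smul]
    congr 1; push_cast; ring

lemma iter_ne {v : MvPolynomial (Fin (d + 1)) ℂ} {c : ℂ} (hv : H d v = c • v)
    (h1 : D1 d v = 0) (h0 : v ≠ 0) (k : ℕ) (hk : ∀ m < k, c ≠ m) :
    (D2 d)^[k] v ≠ 0 := by
  induction k with
  | zero => simpa using h0
  | succ k ih =>
    intro h
    have := D1_iter hv h1 k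
    rw [h, map_zero] at this
    have h3 := smul_eq_zero.1 this.symm
    rcases h3 with h3 | h3
    · rcases mul_eq_zero.1 h3 with h4 | h4
      · exact Nat.cast_add_one_ne_zero k h4
      · exact hk k (by omega) (sub_eq_zero.1 h4)
    · exact ih (fun m hm => hk m (by omega)) h3

lemma iter_zero (k : ℕ) : (D2 d)^[k] 0 = 0 := by
  induction k with
  | zero => rfl
  | succ k ih => rw [Function.iterate_succ_apply, map_zero, ih]

lemma iter_add (k : ℕ) (a b : MvPolynomial (Fin (d + 1)) ℂ) :
    (D2 d)^[k] (a + b) = (D2 d)^[k] a + (D2 d)^[k] b := by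
  induction k with
  | zero => rfl
  | succ k ih => simp only [Function.iterate_succ_apply', ih, map_add]

lemma iter_smul (k : ℕ) (c : ℂ) (b : MvPolynomial (Fin (d + 1)) ℂ) :
    (D2 d)^[k] (c • b) = c • (D2 d)^[k] b := by
  induction k with
  | zero => rfl
  | succ k ih => simp only [Function.iterate_succ_apply', ih, Derivation.map_smul]

lemma nil_mul (s : ℕ) : ∀ (j k : ℕ) (a b : MvPolynomial (Fin (d + 1)) ℂ), j + k = s →
    (D2 d)^[j] a = 0 → (D2 d)^[k] b = 0 → (D2 d)^[s] (a * b) = 0 := by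
  induction s with
  | zero =>
    intro j k a b h ha hb
    obtain rfl : j = 0 := by omega
    simp at ha
    simp [ha]
  | succ s ih =>
    intro j k a b h ha hb
    rcases j with _ | j
    · simp at ha
      rw [ha, zero_mul, iter_zero]
    rcases k with _ | k
    · simp at hb
      rw [hb, mul_zero, iter_zero]
    rw [Function.iterate_succ_apply, Derivation.leibniz, iter_add, smul_eq_mul, smul_eq_mul,
      ih (j + 1) k a _ (by omega) ha (by rwa [Function.iterate_succ_apply] at hb),
      ih (k + 1) j b _ (by omega) hb (by rwa [Function.iterate_succ_apply] at ha), add_zero]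

lemma nil_x (m : ℕ) : ∀ j ≤ d, d - j = m → (D2 d)^[m + 1] (x d j) = 0 := by
  induction m with
  | zero =>
    intro j hj h
    obtain rfl : j = d := by omega
    simp [D2_x]
  | succ m ih =>
    intro j hj h
    rw [Function.iterate_succ_apply, D2_x j hj, iter_smul, ih (j + 1) (by omega) (by omega),
      smul_zero]

lemma nil (p : MvPolynomial (Fin (d + 1)) ℂ) : ∃ k, (D2 d)^[k] p = 0 := by
  induction p using MvPolynomial.induction_on with
  | C a => exact ⟨1, by simp⟩
  | add p q hp hq =>
    obtain ⟨k, hk⟩ := hp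
    obtain ⟨l, hl⟩ := hq
    refine ⟨k + l, ?_⟩
    rw [iter_add, Function.iterate_add_apply _ k l q, hl, add_comm k l,
      Function.iterate_add_apply, hk, iter_zero, iter_zero, add_zero]
  | mul_X p n hp =>
    obtain ⟨k, hk⟩ := hp
    obtain ⟨j, hj⟩ := n
    refine ⟨_, nil_mul _ k (d - j + 1) _ _ rfl hk ?_⟩
    rw [← x_eq j hj]
    exact nil_x _ j (by omega) rfl

lemma Z_eq (i : ℕ) : Z d i = (∑ k ∈ Finset.range (i - 1),
      C ((-1 : ℂ) ^ k * (i.choose k : ℂ)) * x d (i - k) * x d 1 ^ k * x d 0 ^ (i - k - 1)) +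
    C (((i : ℂ) - 1) * (-1 : ℂ) ^ (i + 1)) * x d 1 ^ i := rfl

lemma H_Z (hd : 2 ≤ d) (i : ℕ) (h2 : 2 ≤ i) (hid : i ≤ d) :
    H d (Z d i) = (((d - 2) * i : ℕ) : ℂ) • Z d i := by
  rw [Z_eq, map_add, smul_add, map_sum, Finset.smul_sum]
  congr 1
  · apply Finset.sum_congr rfl
    intro k hk
    rw [Finset.mem_range] at hk
    refine eig_mul (eig_mul (eig_mul (eig_C _) (H_x (i - k) (by omega)) rfl)
      (eig_pow (H_x 1 (by omega)) k) rfl) (eig_pow (H_x 0 (by omega)) _) ?_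
    rw [Nat.cast_mul, Nat.cast_sub hd, Nat.cast_sub (show 1 ≤ i - k by omega),
      Nat.cast_sub (show k ≤ i by omega)]
    push_cast
    ring
  · refine eig_mul (eig_C _) (eig_pow (H_x 1 (by omega)) _) ?_
    rw [Nat.cast_mul, Nat.cast_sub hd]
    push_cast
    ring

lemma t_Z (i : ℕ) (h2 : 2 ≤ i) : x d 0 * Z d i = ∑ k ∈ Finset.range (i + 1),
      C ((-1 : ℂ) ^ k * (i.choose k : ℂ)) * (x d (i - k) * x d 1 ^ k * x d 0 ^ (i - k)) := by
  obtain ⟨n, rfl⟩ : ∃ n, i = n + 1 := ⟨i - 1, by omega⟩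
  rw [Finset.sum_range_succ, Finset.sum_range_succ, add_assoc, Z_eq, mul_add, Finset.mul_sum]
  have hA : ∀ k ∈ Finset.range n,
      x d 0 * (C ((-1 : ℂ) ^ k * ((n + 1).choose k : ℂ)) * x d (n + 1 - k) * x d 1 ^ k *
        x d 0 ^ (n + 1 - k - 1)) =
      C ((-1 : ℂ) ^ k * ((n + 1).choose k : ℂ)) *
        (x d (n + 1 - k) * x d 1 ^ k * x d 0 ^ (n + 1 - k)) := by
    intro k hk
    rw [Finset.mem_range] at hk
    obtain ⟨m, hm⟩ : ∃ m, n + 1 - k = m + 1 := ⟨n - k, by omega⟩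
    rw [hm, Nat.add_sub_cancel, pow_succ (x d 0)]
    generalize C ((-1 : ℂ) ^ k * ((n + 1).choose k : ℂ)) = c
    ring
  rw [Nat.add_sub_cancel, Finset.sum_congr rfl hA]
  refine congrArg _ ?_
  have e : n + 1 - n = 1 := by omega
  rw [e, Nat.sub_self, Nat.choose_self, Nat.choose_succ_self_right]
  have e2 : ((n + 1 : ℕ) : ℂ) - 1 = (n : ℂ) := by push_cast; ring
  rw [e2]
  simp only [map_mul, map_pow, map_neg, map_one, map_natCast, pow_succ, pow_zero]
  push_cast
  ring

lemma D1_Z (hd : 2 ≤ d) (i : ℕ) (h2 : 2 ≤ i) (hid : i ≤ d) : D1 d (Z d i) = 0 := by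
  have h0 : x d 0 ≠ 0 := MvPolynomial.X_ne_zero _
  have ht : D1 d (x d 0) = 0 := by rw [D1_x 0 (by omega)]; simp
  have key : D1 d (x d 0 * Z d i) = 0 := by
    rw [t_Z i h2, map_sum]
    let f : ℕ → MvPolynomial (Fin (d + 1)) ℂ := fun k =>
      C ((-1 : ℂ) ^ k * (i.choose k : ℂ) * k) *
        (x d (i - k) * x d 1 ^ (k - 1) * x d 0 ^ (i - k + 1))
    have : ∀ k ∈ Finset.range (i + 1),
        D1 d (C ((-1 : ℂ) ^ k * (i.choose k : ℂ)) * (x d (i - k) * x d 1 ^ k * x d 0 ^ (i - k)))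
          = f k - f (k + 1) := by
      intro k hk
      rw [Finset.mem_range] at hk
      have hc : ((i.choose (k + 1) : ℕ) : ℂ) * ((k : ℂ) + 1) = i.choose k * ((i - k : ℕ) : ℂ) := by
        exact_mod_cast Nat.choose_succ_right_eq i k
      have e1 : f (k + 1) = - (C ((-1 : ℂ) ^ k * (i.choose k : ℂ) * ((i - k : ℕ) : ℂ)) *
          (x d (i - k - 1) * x d 1 ^ k * x d 0 ^ (i - k))) := by
        have : (-1 : ℂ) ^ (k + 1) * (i.choose (k + 1) : ℂ) * ((k + 1 : ℕ) : ℂ)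
            = - ((-1 : ℂ) ^ k * (i.choose k : ℂ) * ((i - k : ℕ) : ℂ)) := by
          rw [mul_assoc _ (i.choose k : ℂ), ← hc]; push_cast; ring
        simp only [f]
        rw [this, map_neg, neg_mul, Nat.add_sub_cancel]
        rcases Nat.lt_or_ge k i with h | h
        · rw [show i - (k + 1) + 1 = i - k by omega, Nat.sub_sub]
        · rw [show i - k = 0 by omega]; simp
      rw [e1, ← MvPolynomial.smul_eq_C_mul, Derivation.map_smul, Derivation.leibniz,
        Derivation.leibniz, Derivation.leibniz_pow, Derivation.leibniz_pow, ht,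
        D1_x _ (by omega), D1_x _ (by omega)]
      simp only [f, MvPolynomial.smul_eq_C_mul, smul_eq_mul, nsmul_eq_mul, map_mul, map_natCast,
        mul_zero, Nat.sub_self, pow_succ]
      push_cast
      ring
    rw [Finset.sum_congr rfl this, Finset.sum_range_sub']
    simp [f]
  rw [Derivation.leibniz, ht, smul_zero, add_zero, smul_eq_mul] at key
  exact (mul_eq_zero.1 key).resolve_left h0

lemma Z_ne (hd : 2 ≤ d) (i : ℕ) (h2 : 2 ≤ i) (hid : i ≤ d) : Z d i ≠ 0 := by
  intro h
  have hx : ∀ j ≤ d, MvPolynomial.eval (fun m : Fin (d + 1) => if (m : ℕ) = 1 then (1 : ℂ) else 0)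
      (x d j) = if j = 1 then 1 else 0 := by
    intro j hj
    rw [x_eq j (by omega), eval_X]
  have := congrArg
    (MvPolynomial.eval (fun m : Fin (d + 1) => if (m : ℕ) = 1 then (1 : ℂ) else 0)) h
  rw [Z_eq, map_add, map_sum, Finset.sum_eq_zero] at this
  · simp only [map_mul, map_pow, hx 1 (by omega), eval_C, map_zero, zero_add, if_true, one_pow,
      mul_one] at this
    rcases mul_eq_zero.1 this with h | h
    · have : (i : ℂ) = (1 : ℕ) := by simpa using sub_eq_zero.1 h
      have := Nat.cast_injective this
      omega
    · exact pow_ne_zero _ (by norm_num) h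
  · intro k hk
    rw [Finset.mem_range] at hk
    simp only [map_mul, hx (i - k) (by omega), if_neg (show ¬ (i - k = 1) by omega)]
    simp

end ZAux

/-- For every `d ≥ 2` and every `2 ≤ i ≤ d`, the semi-invariant `z_i` has
`D2`-order `(d−2)·i`: it has weight `(d−2)·i`, `D2^{(d−2)i+1}(z_i) = 0`, and
`D2^{(d−2)i}(z_i) ≠ 0`. -/
theorem Z_order (d : ℕ) (hd : 2 ≤ d) (i : ℕ) (h2 : 2 ≤ i) (hid : i ≤ d) :
    D1 d (D2 d (Z d i)) - D2 d (D1 d (Z d i)) = (((d - 2) * i : ℕ) : ℂ) • Z d i ∧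
      (⇑(D2 d))^[(d - 2) * i + 1] (Z d i) = 0 ∧
      (⇑(D2 d))^[(d - 2) * i] (Z d i) ≠ 0 := by
  have hH := ZAux.H_Z hd i h2 hid
  have h1 := ZAux.D1_Z hd i h2 hid
  have h0 := ZAux.Z_ne hd i h2 hid
  refine ⟨?_, ?_, ?_⟩
  · rw [← ZAux.H_apply]; exact hH
  · by_contra hne
    have hw := ZAux.eig_iter hH ((d - 2) * i + 1)
    have hw1 := ZAux.D1_iter hH h1 ((d - 2) * i)
    rw [sub_self, mul_zero, zero_smul] at hw1
    obtain ⟨k, hk⟩ := ZAux.nil ((⇑(D2 d))^[(d - 2) * i + 1] (Z d i))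
    refine ZAux.iter_ne hw hw1 hne k ?_ hk
    intro m _ hm
    have h5 : (((d - 2) * i : ℕ) : ℂ) = ((m + 2 * ((d - 2) * i + 1) : ℕ) : ℂ) := by
      rw [sub_eq_iff_eq_add] at hm
      rw [hm]; push_cast; ring
    have h6 := Nat.cast_injective h5
    omega
  · apply ZAux.iter_ne hH h1 h0
    intro m hm h
    have h6 := Nat.cast_injective h
    omega
end
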